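/- arXiv:math/0204337 — 2 statements merged into one kernel-verified Lean document; each statement's English description precedes it below -/
import Mathlib

section
/- Let H be a finite-dimensional Hopf algebra over a field k and Q a quotient bialgebra of H (H/I for a biideal I). Then dim Q divides dim H. (Special, ordinary-Hopf case of the paper's Lagrange theorem for quasi-Hopf algebras, derived via the Nichols–Zoeller theorem applied to the inclusion Q* ⊆ H*.) -/
open TensorProduct Coalgebra HopfAlgebra

section Corepresentation

variable {k : Type*} [Field k] {Q : Type*} [Ring Q]

/-- A square matrix over a bialgebra is a *corepresentation* if its entries comultiply like the
matrix coefficients of a comodule. -/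
structure IsCorepresentation (k : Type*) [Field k] {Q : Type*} [Ring Q] [Bialgebra k Q]
    {ι : Type*} [Fintype ι] [DecidableEq ι] (c : Matrix ι ι Q) : Prop where
  comul_apply : ∀ i j, comul (R := k) (c i j) = ∑ l, c i l ⊗ₜ[k] c l j
  counit_apply : ∀ i j, counit (R := k) (c i j) = if i = j then 1 else 0

namespace IsCorepresentation

variable {ι : Type*} [Fintype ι] [DecidableEq ι] {c : Matrix ι ι Q}

theorem map_mul_self [HopfAlgebra k Q] (hc : IsCorepresentation k c) :
    c.map (antipode k) * c = 1 := by
  ext i j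
  have h := mul_antipode_rTensor_comul_apply (R := k) (c i j)
  rw [hc.comul_apply, hc.counit_apply] at h
  simpa [Matrix.mul_apply, Matrix.one_apply, apply_ite] using h

theorem self_mul_map [HopfAlgebra k Q] (hc : IsCorepresentation k c) :
    c * c.map (antipode k) = 1 := by
  ext i j
  have h := mul_antipode_lTensor_comul_apply (R := k) (c i j)
  rw [hc.comul_apply, hc.counit_apply] at h
  simpa [Matrix.mul_apply, Matrix.one_apply, apply_ite] using h

theorem sum_antipode_mul [HopfAlgebra k Q] (hc : IsCorepresentation k c) (i j : ι) :
    ∑ l, antipode k (c i l) * c l j = if i = j then 1 else 0 := by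
  simpa [Matrix.mul_apply, Matrix.one_apply] using congrFun (congrFun hc.map_mul_self i) j

theorem sum_mul_antipode [HopfAlgebra k Q] (hc : IsCorepresentation k c) (i j : ι) :
    ∑ l, c i l * antipode k (c l j) = if i = j then 1 else 0 := by
  simpa [Matrix.mul_apply, Matrix.one_apply] using congrFun (congrFun hc.self_mul_map i) j

theorem transpose_map_antipode [HopfAlgebra k Q] (hc : IsCorepresentation k c) :
    IsCorepresentation k (c.map (antipode k)).transpose := by
  have key : (c.map (antipode k)).map (Bialgebra.comulAlgHom k Q) =
      (c.map (antipode k)).map (Algebra.TensorProduct.includeRight : Q →ₐ[k] Q ⊗[k] Q) *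
      (c.map (antipode k)).map (Algebra.TensorProduct.includeLeft : Q →ₐ[k] Q ⊗[k] Q) := by
    have hmap (f : Q →ₐ[k] Q ⊗[k] Q) : c.map f * (c.map (antipode k)).map f = 1 := by
      have h := congrArg (fun M : Matrix ι ι Q => M.map f) hc.self_mul_map
      simpa [Matrix.map_mul] using h
    have hmap' (f : Q →ₐ[k] Q ⊗[k] Q) : (c.map (antipode k)).map f * c.map f = 1 := by
      have h := congrArg (fun M : Matrix ι ι Q => M.map f) hc.map_mul_self
      simpa [Matrix.map_mul] using h
    have hΔ : c.map (Bialgebra.comulAlgHom k Q) =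
      c.map (Algebra.TensorProduct.includeLeft : Q →ₐ[k] Q ⊗[k] Q) *
      c.map (Algebra.TensorProduct.includeRight : Q →ₐ[k] Q ⊗[k] Q) := by
      ext i j
      simp [Matrix.mul_apply, hc.comul_apply]
    refine (left_inv_eq_right_inv (a := c.map (Bialgebra.comulAlgHom k Q)) ?_ (hmap _)).symm
    rw [hΔ, Matrix.mul_assoc, ← Matrix.mul_assoc _ _ (c.map _), hmap', Matrix.one_mul, hmap']
  refine ⟨fun i j => ?_, fun i j => ?_⟩
  · have h := congrFun (congrFun key j) i
    simpa [Matrix.mul_apply] using h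
  · simp [hc.counit_apply, eq_comm]

end IsCorepresentation

theorem eq_of_sum_basis_tmul_eq {M N ι : Type*} [Fintype ι] [AddCommGroup M] [Module k M]
    [AddCommGroup N] [Module k N] (b : Module.Basis ι k M) {x y : ι → N}
    (hxy : ∑ i, b i ⊗ₜ[k] x i = ∑ i, b i ⊗ₜ[k] y i) : x = y :=
  Finsupp.equivFunOnFinite.symm.injective <|
    TensorProduct.sum_tmul_basis_left_injective (N := N) b
      (by simpa [Finsupp.sum_fintype] using hxy)

/-- The matrix coefficients of the regular right coaction. -/
theorem exists_comul_basis_eq [Bialgebra k Q] {ι : Type*} [Fintype ι] [DecidableEq ι]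
    (b : Module.Basis ι k Q) : ∃ c : Matrix ι ι Q, IsCorepresentation k c ∧
      ∀ j, comul (R := k) (b j) = ∑ i, b i ⊗ₜ[k] c i j := by
  have h (j : ι) : ∃ d : ι → Q, comul (R := k) (b j) = ∑ i, b i ⊗ₜ[k] d i := by
    obtain ⟨d, hd⟩ := TensorProduct.eq_repr_basis_left b (comul (R := k) (b j))
    exact ⟨d, by rw [← hd, Finsupp.sum_fintype _ _ (by simp)]⟩
  choose d hd using h
  refine ⟨fun i j => d j i, ⟨fun i j => ?_, fun i j => ?_⟩, hd⟩
  · have h := coassoc_apply (R := k) (b j)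
    simp only [hd, map_sum, LinearMap.rTensor_tmul, LinearMap.lTensor_tmul, sum_tmul,
      TensorProduct.assoc_tmul] at h
    rw [Finset.sum_comm] at h
    simp only [← tmul_sum] at h
    exact (congrFun (eq_of_sum_basis_tmul_eq b h) i).symm
  · have h := lTensor_counit_comul (R := k) (b j)
    simp only [hd, map_sum, LinearMap.lTensor_tmul] at h
    have h2 := eq_of_sum_basis_tmul_eq b (x := fun i => counit (R := k) (d j i))
      (y := fun i => if i = j then 1 else 0) (by rw [h]; simp [tmul_ite])
    exact congrFun h2 i

/-- A linear form `l` on a bialgebra is a *right integral* if `l(x₁) x₂ = l(x) 1`. -/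
def IsRightIntegral [Bialgebra k Q] (l : Q →ₗ[k] k) : Prop :=
  ∀ x, TensorProduct.lid k Q (l.rTensor Q (comul (R := k) x)) = l x • 1

theorem exists_isRightIntegral_ne_zero [HopfAlgebra k Q] [FiniteDimensional k Q] [Nontrivial Q] :
    ∃ l : Q →ₗ[k] k, IsRightIntegral l ∧ l ≠ 0 := by
  classical
  let b := Module.finBasis k Q
  obtain ⟨c, hc, hb⟩ := exists_comul_basis_eq b
  obtain ⟨s, hs⟩ : ∃ s : Matrix _ _ Q, s = c.map (antipode k) := ⟨_, rfl⟩
  obtain ⟨e, he⟩ : ∃ e : Matrix _ _ Q, e = s.map (antipode k) := ⟨_, rfl⟩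
  have hs' : IsCorepresentation k s.transpose := hs ▸ hc.transpose_map_antipode
  have he' : IsCorepresentation k e := he ▸ hs'.transpose_map_antipode
  have hse : ∀ p q, ∑ l, s l q * e p l = if q = p then 1 else 0 := fun p q =>
    he ▸ hs'.sum_mul_antipode q p
  have hes : ∀ p q, ∑ m, e m p * s q m = if p = q then 1 else 0 := fun p q =>
    he ▸ hs'.sum_antipode_mul p q
  have hsc : ∀ p q, ∑ l, s p l * c l q = if p = q then 1 else 0 := fun p q =>
    hs ▸ hc.sum_antipode_mul p q
  let B (i : Fin (Module.finrank k Q)) : Q ⊗[k] Q →ₗ[k] Q :=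
    TensorProduct.lid k Q ∘ₗ (b.coord i).rTensor Q
  have hB (i x y) : B i (x ⊗ₜ y) = b.coord i x • y := by simp [B]
  have hcoord (i y) : B i (comul y) = ∑ j, b.coord j y • c i j := by
    conv_lhs => rw [← b.sum_repr y]
    simp only [map_sum, map_smul, hb, hB]
    simp [Finsupp.single_apply]
  have hmul (i u v t) : B i ((u ⊗ₜ v) * t) = v * B i ((u ⊗ₜ 1) * t) := by
    induction t with
    | zero => simp
    | add x y hx hy => simp only [mul_add, map_add, hx, hy]
    | tmul x y => simp [hB]
  let L (m : Fin (Module.finrank k Q)) : Q →ₗ[k] k :=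
    ∑ j, b.coord j ∘ₗ LinearMap.mulLeft k (e m j)
  have hL (m x) : L m x = ∑ j, b.coord j (e m j * x) := by simp [L]
  have hLB (m t) : TensorProduct.lid k Q ((L m).rTensor Q t) = ∑ l, B l ((e m l ⊗ₜ 1) * t) := by
    induction t with
    | zero => simp
    | add x y hx hy => simp only [mul_add, map_add, hx, hy, Finset.sum_add_distrib]
    | tmul x y => simp [hB, hL, Finset.sum_smul]
  have hint (m) : IsRightIntegral (L m) := fun x => by
    have h1 (l l') : ∑ p, e p l' * B l ((e m p ⊗ₜ 1) * comul x) =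
        ∑ j, b.coord j (e m l' * x) • c l j := by
      rw [← hcoord, Bialgebra.comul_mul, he'.comul_apply, Finset.sum_mul, map_sum]
      exact Finset.sum_congr rfl fun p _ => (hmul ..).symm
    have h2 (l q) : B l ((e m q ⊗ₜ 1) * comul x) =
        ∑ l', ∑ j, b.coord j (e m l' * x) • (s l' q * c l j) := by
      simp only [← mul_smul_comm, ← Finset.mul_sum, ← h1]
      simp only [Finset.mul_sum, ← mul_assoc]
      rw [Finset.sum_comm]
      simp [← Finset.sum_mul, hse]
    have h3 (l') : ∑ l, ∑ j, b.coord j (e m l' * x) • (s l' l * c l j) =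
        b.coord l' (e m l' * x) • 1 := by
      rw [Finset.sum_comm]
      simp only [← Finset.smul_sum, hsc]
      simp
    rw [hLB, hL]
    simp only [h2]
    rw [Finset.sum_comm]
    simp only [h3, Finset.sum_smul]
  by_contra! hcon
  obtain ⟨i⟩ : Nonempty (Fin (Module.finrank k Q)) := b.index_nonempty
  have h : ∑ m, L m (s i m * b i) = 1 := by
    simp only [hL]
    rw [Finset.sum_comm]
    simp only [← map_sum, ← mul_assoc, ← Finset.sum_mul, hes]
    rw [Finset.sum_eq_single i] <;> simp +contextual
  simp [hcon _ (hint _)] at h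

theorem antipode_injective [HopfAlgebra k Q] [FiniteDimensional k Q] :
    Function.Injective (antipode k : Q →ₗ[k] Q) := by
  classical
  nontriviality Q
  obtain ⟨l, hl, hl0⟩ := exists_isRightIntegral_ne_zero (k := k) (Q := Q)
  let b := Module.finBasis k Q
  obtain ⟨c, hc, hb⟩ := exists_comul_basis_eq b
  let Λ : Q ⊗[k] Q →ₗ[k] Q := TensorProduct.lid k Q ∘ₗ l.rTensor Q
  have hΛ (x y) : Λ (x ⊗ₜ y) = l x • y := by simp [Λ]
  have hΛc (x) : Λ (comul x) = l x • 1 := hl x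
  have hmul (u v t) : Λ ((u ⊗ₜ v) * t) = v * Λ ((u ⊗ₜ 1) * t) := by
    induction t with
    | zero => simp
    | add x y hx hy => simp only [mul_add, map_add, hx, hy]
    | tmul x y => simp [hΛ]
  have h1 (i j h) : ∑ p, l (antipode k (c p j) * h) • c i p =
      Λ ((antipode k (c i j) ⊗ₜ 1) * comul h) := by
    have h2 (p) : l (antipode k (c p j) * h) • (1 : Q) = ∑ q, antipode k (c p q) *
        Λ ((antipode k (c q j) ⊗ₜ 1) * comul h) := by
      rw [← hΛc, Bialgebra.comul_mul, show comul (antipode k (c p j)) = _ from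
        hc.transpose_map_antipode.comul_apply j p, Finset.sum_mul, map_sum]
      exact Finset.sum_congr rfl fun q _ => hmul ..
    have h3 (p) : l (antipode k (c p j) * h) • c i p = c i p * ∑ q, antipode k (c p q) *
        Λ ((antipode k (c q j) ⊗ₜ 1) * comul h) := by
      rw [← h2]; simp
    simp only [h3, Finset.mul_sum, ← mul_assoc]
    rw [Finset.sum_comm]
    simp [← Finset.sum_mul, hc.sum_mul_antipode]
  have hbc (j) : b j = ∑ i, counit (R := k) (b i) • c i j := by
    have h := rTensor_counit_comul (R := k) (b j)
    simpa [hb] using (congrArg (TensorProduct.lid k Q) h).symm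
  let cc (x : Q) (i) : Q := ∑ j, b.coord j x • c i j
  have hcc (x) : comul x = ∑ i, b i ⊗ₜ[k] cc x i := by
    conv_lhs => rw [← b.sum_repr x]
    simp only [map_sum, map_smul, hb, cc, tmul_sum, tmul_smul, Finset.smul_sum]
    rw [Finset.sum_comm]
    simp
  have h4 (x h) : ∑ i, l (antipode k (cc x i) * h) • b i =
      Λ ((antipode k x ⊗ₜ 1) * comul h) := by
    have hj (j) : ∑ i, l (antipode k (c i j) * h) • b i =
        Λ ((antipode k (b j) ⊗ₜ 1) * comul h) := by
      conv_rhs => rw [hbc j]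
      conv_lhs => enter [2, i]; rw [hbc i]
      simp only [map_sum, map_smul, sum_tmul, ← smul_tmul', Finset.sum_mul, smul_mul_assoc, ← h1,
        Finset.smul_sum]
      rw [Finset.sum_comm]
      exact Finset.sum_congr rfl fun _ _ => Finset.sum_congr rfl fun _ _ => smul_comm ..
    conv_rhs => rw [← b.sum_repr x]
    simp only [map_sum, map_smul, sum_tmul, ← smul_tmul', Finset.sum_mul, smul_mul_assoc, ← hj, cc,
      Finset.smul_sum, Finset.sum_smul, smul_eq_mul, mul_smul]
    rw [Finset.sum_comm]
    rfl
  have hJ (x) (hx : ∀ h, l (antipode k x * h) = 0) (i h) : l (antipode k (cc x i) * h) = 0 := by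
    have h5 (t) : Λ ((antipode k x ⊗ₜ 1) * t) = 0 := by
      induction t with
      | zero => simp
      | add x y hx hy => simp only [mul_add, map_add, hx, hy, add_zero]
      | tmul y z => simp [hΛ, hx]
    have h6 := h4 x h
    rw [h5] at h6
    exact Fintype.linearIndependent_iff.1 b.linearIndependent _ h6 i
  have hJε (x) (hx : ∀ h, l (antipode k x * h) = 0) : counit (R := k) x = 0 := by
    have h5 : ∑ i, antipode k (b i) * cc x i = counit (R := k) x • 1 := by
      have h := mul_antipode_rTensor_comul_apply (R := k) x
      simpa [hcc, Algebra.algebraMap_eq_smul_one] using h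
    by_contra h0
    refine hl0 (LinearMap.ext fun h => ?_)
    have h6 : l (antipode k (counit (R := k) x • 1) * h) = 0 := by
      simp only [← h5, map_sum, Finset.sum_mul, antipode_mul_antidistrib, mul_assoc]
      exact Finset.sum_eq_zero fun i _ => hJ x hx i _
    simpa [h0] using h6
  rw [injective_iff_map_eq_zero]
  intro x hx
  have hx' (h) : l (antipode k x * h) = 0 := by simp [hx]
  have h := lTensor_counit_comul (R := k) x
  simpa [hcc, fun i => hJε _ (hJ x hx' i)] using (congrArg (TensorProduct.rid k Q) h).symm
namespace IsCorepresentation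

theorem sum_mul_antipode_inv [HopfAlgebra k Q] [FiniteDimensional k Q] {ι : Type*} [Fintype ι]
    [DecidableEq ι] {c : Matrix ι ι Q} (hc : IsCorepresentation k c) {T : Q → Q}
    (hT : ∀ x, antipode k (T x) = x) (i j : ι) :
    ∑ l, c l i * T (c j l) = if j = i then 1 else 0 := by
  apply antipode_injective (k := k)
  simp only [map_sum, antipode_mul_antidistrib, hT, hc.sum_mul_antipode]
  split_ifs <;> simp

end IsCorepresentation

theorem eq_of_sum_tmul_eq {M N ι : Type*} [Fintype ι] [AddCommGroup M] [Module k M]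
    [AddCommGroup N] [Module k N] {v : ι → N} (hv : LinearIndependent k v) {x y : ι → M}
    (hxy : ∑ i, x i ⊗ₜ[k] v i = ∑ i, y i ⊗ₜ[k] v i) : x = y := by
  classical
  obtain ⟨g, hg⟩ := LinearMap.exists_leftInverse_of_injective
    (Fintype.linearCombination k v) (LinearMap.ker_eq_bot.2 hv.fintypeLinearCombination_injective)
  have hgv (i) : g (v i) = Pi.basisFun k ι i := by
    have h := LinearMap.congr_fun hg (Pi.single i 1)
    simpa [Fintype.linearCombination_apply_single] using h
  have h := congrArg (g.lTensor M) hxy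
  simp only [map_sum, LinearMap.lTensor_tmul, hgv] at h
  exact Finsupp.equivFunOnFinite.symm.injective <|
    TensorProduct.sum_tmul_basis_right_injective (M := M) (Pi.basisFun k ι)
      (by simpa [Finsupp.sum_fintype] using h)

/-- `ρ` makes `M` a left comodule over `Q`. -/
structure IsLeftCoaction [Bialgebra k Q] {M : Type*} [AddCommGroup M] [Module k M]
    (ρ : M →ₗ[k] Q ⊗[k] M) : Prop where
  assoc_comul : ∀ m, TensorProduct.assoc k Q Q M ((comul (R := k)).rTensor M (ρ m)) =
    ρ.lTensor Q (ρ m)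
  lid_counit : ∀ m, TensorProduct.lid k M ((counit (R := k)).rTensor M (ρ m)) = m

/-- The coefficients of a coaction on a linearly independent family form a corepresentation. -/
theorem IsLeftCoaction.isCorepresentation [Bialgebra k Q] {M ι : Type*} [AddCommGroup M]
    [Module k M] [Fintype ι] [DecidableEq ι] {ρ : M →ₗ[k] Q ⊗[k] M} (hρ : IsLeftCoaction ρ)
    {v : ι → M} (hv : LinearIndependent k v) {c : Matrix ι ι Q}
    (hc : ∀ j, ρ (v j) = ∑ i, c j i ⊗ₜ[k] v i) : IsCorepresentation k c := by
  refine ⟨fun i j => ?_, fun i j => ?_⟩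
  · have h := hρ.assoc_comul (v i)
    simp only [hc, map_sum, LinearMap.rTensor_tmul, LinearMap.lTensor_tmul, tmul_sum] at h
    rw [Finset.sum_comm] at h
    simp only [← TensorProduct.assoc_tmul, ← map_sum, ← sum_tmul] at h
    exact congrFun (eq_of_sum_tmul_eq hv ((TensorProduct.assoc k Q Q M).injective h)) j
  · have h := hρ.lid_counit (v i)
    simp only [hc, map_sum, LinearMap.rTensor_tmul, TensorProduct.lid_tmul] at h
    have h2 : (fun j => counit (R := k) (c i j)) = fun j => if i = j then 1 else 0 := by
      refine funext fun j => ?_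
      have h3 := Fintype.linearIndependent_iff.1 hv
        (fun j => counit (R := k) (c i j) - if i = j then 1 else 0) ?_ j
      · exact sub_eq_zero.1 h3
      · simp [sub_smul, h]
    exact congrFun h2 j

theorem exists_corepresentation_basis [Bialgebra k Q] {ι : Type*} [Fintype ι] [DecidableEq ι]
    (b : Module.Basis ι k Q) : ∃ c : Matrix ι ι Q, IsCorepresentation k c ∧
      ∀ j, comul (R := k) (b j) = ∑ i, c j i ⊗ₜ[k] b i := by
  have h (j : ι) : ∃ d : ι → Q, comul (R := k) (b j) = ∑ i, d i ⊗ₜ[k] b i := by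
    obtain ⟨d, hd⟩ := TensorProduct.eq_repr_basis_right b (comul (R := k) (b j))
    exact ⟨d, by rw [← hd, Finsupp.sum_fintype _ _ (by simp)]⟩
  choose d hd using h
  refine ⟨d, IsLeftCoaction.isCorepresentation (ρ := comul (R := k)) ⟨fun m => ?_, fun m => ?_⟩
    b.linearIndependent hd, hd⟩ <;> simp

section Induced

variable {H : Type*} [Ring H] [HopfAlgebra k H] [HopfAlgebra k Q] (ν : H →ₐc[k] Q)
  (X : Type*) [AddCommGroup X] [Module k X]

/-- The left `Q`-coaction on `H` along `ν`, tensored with the trivial coaction on `X`. -/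
noncomputable def inducedCoaction : H ⊗[k] X →ₗ[k] Q ⊗[k] (H ⊗[k] X) :=
  TensorProduct.assoc k Q H X ∘ₗ
    (((ν : H →ₗ[k] Q).rTensor H ∘ₗ comul (R := k)).rTensor X)

/-- The map `(q ⊗ x) ⊗ h ↦ q ν(h₁) ⊗ (x ⊗ h₂)`. -/
noncomputable def twist : (Q ⊗[k] X) ⊗[k] H →ₗ[k] Q ⊗[k] (X ⊗[k] H) :=
  (LinearMap.mul' k Q).rTensor (X ⊗[k] H) ∘ₗ
    (TensorProduct.tensorTensorTensorComm k Q X Q H).toLinearMap ∘ₗ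
      ((ν : H →ₗ[k] Q).rTensor H ∘ₗ comul (R := k)).lTensor (Q ⊗[k] X)

variable {X}

theorem inducedCoaction_tmul {h : H} {ι : Type*} {s : Finset ι} {l r : ι → H}
    (hh : comul (R := k) h = ∑ i ∈ s, l i ⊗ₜ[k] r i) (x : X) :
    inducedCoaction ν X (h ⊗ₜ x) = ∑ i ∈ s, ν (l i) ⊗ₜ[k] (r i ⊗ₜ[k] x) := by
  simp [inducedCoaction, hh, sum_tmul]

theorem twist_tmul {h : H} {ι : Type*} {s : Finset ι} {l r : ι → H}
    (hh : comul (R := k) h = ∑ i ∈ s, l i ⊗ₜ[k] r i) (q : Q) (x : X) :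
    twist ν X ((q ⊗ₜ x) ⊗ₜ h) = ∑ i ∈ s, (q * ν (l i)) ⊗ₜ[k] (x ⊗ₜ[k] r i) := by
  simp [twist, hh, tmul_sum]

theorem twist_surjective [FiniteDimensional k H] : Function.Surjective (twist ν X) := by
  classical
  let b := Module.finBasis k H
  obtain ⟨d, hd, hb⟩ := exists_corepresentation_basis b
  rw [← LinearMap.range_eq_top, eq_top_iff, ← TensorProduct.span_tmul_eq_top, Submodule.span_le]
  rintro _ ⟨q, y, rfl⟩
  have key (q : Q) (x : X) (i) : q ⊗ₜ (x ⊗ₜ b i) ∈ LinearMap.range (twist ν X) := by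
    refine ⟨∑ l, (q * ν (antipode k (d i l)) ) ⊗ₜ x ⊗ₜ b l, ?_⟩
    simp only [map_sum, twist_tmul ν (hb _)]
    rw [Finset.sum_comm]
    simp only [← sum_tmul, mul_assoc, ← Finset.mul_sum, ← map_mul, ← map_sum, hd.sum_antipode_mul]
    rw [Finset.sum_eq_single i] <;> simp +contextual [eq_comm]
  induction y with
  | zero => simp
  | add y z hy hz => rw [tmul_add]; exact add_mem hy hz
  | tmul x h =>
    rw [← b.sum_repr h]
    simp only [tmul_sum, tmul_smul]
    exact sum_mem fun i _ => Submodule.smul_mem _ _ (key q x i)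

theorem lTensor_rTensor_comp_twist {Y : Type*} [AddCommGroup Y] [Module k Y] (f : X →ₗ[k] Y) :
    (f.rTensor H).lTensor Q ∘ₗ twist ν X = twist ν Y ∘ₗ (f.lTensor Q).rTensor H := by
  ext q x h
  simp [twist_tmul ν (ℛ k h).eq.symm]

theorem isLeftCoaction_inducedCoaction [FiniteDimensional k H] :
    IsLeftCoaction (inducedCoaction ν X) := by
  classical
  let b := Module.finBasis k H
  obtain ⟨d, hd, hb⟩ := exists_corepresentation_basis b
  have hνd (i j) : comul (R := k) (ν (d i j)) = ∑ l, ν (d i l) ⊗ₜ[k] ν (d l j) := by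
    rw [← CoalgHomClass.map_comp_comul_apply, hd.comul_apply]
    simp
  have hνc (i j) : counit (R := k) (ν (d i j)) = if i = j then 1 else 0 := by
    rw [CoalgHomClass.counit_comp_apply, hd.counit_apply]
  constructor
  · refine LinearMap.congr_fun (f := (TensorProduct.assoc k Q Q (H ⊗[k] X)).toLinearMap ∘ₗ
      (comul (R := k)).rTensor (H ⊗[k] X) ∘ₗ inducedCoaction ν X)
      (g := (inducedCoaction ν X).lTensor Q ∘ₗ inducedCoaction ν X)
      (TensorProduct.ext (b.ext fun j => LinearMap.ext fun x => ?_))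
    simp only [LinearMap.compr₂ₛₗ_apply, TensorProduct.mk_apply, LinearMap.comp_apply,
      inducedCoaction_tmul ν (hb _), map_sum, LinearMap.rTensor_tmul, hνd, sum_tmul,
      LinearMap.lTensor_tmul, tmul_sum, LinearEquiv.coe_coe, TensorProduct.assoc_tmul]
    exact Finset.sum_comm
  · refine LinearMap.congr_fun (f := (TensorProduct.lid k (H ⊗[k] X)).toLinearMap ∘ₗ
      (counit (R := k)).rTensor (H ⊗[k] X) ∘ₗ inducedCoaction ν X) (g := LinearMap.id)
      (TensorProduct.ext (b.ext fun j => LinearMap.ext fun x => ?_))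
    simp [inducedCoaction_tmul ν (hb _), hνc]

theorem inducedCoaction_comp_twist [FiniteDimensional k H] :
    inducedCoaction ν (X ⊗[k] H) ∘ₗ twist (BialgHom.id k H) X =
      (twist (BialgHom.id k H) X).lTensor Q ∘ₗ twist ν (H ⊗[k] X) ∘ₗ
        (inducedCoaction ν X).rTensor H := by
  classical
  let b := Module.finBasis k H
  obtain ⟨d, hd, hb⟩ := exists_corepresentation_basis b
  refine TensorProduct.ext (TensorProduct.ext (LinearMap.ext₂ fun h x => b.ext fun j => ?_))
  have hmul (i) : comul (R := k) (h * d j i) = ∑ p ∈ (ℛ k h).index ×ˢ Finset.univ,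
      ((ℛ k h).left p.1 * d j p.2) ⊗ₜ[k] ((ℛ k h).right p.1 * d p.2 i) := by
    rw [Bialgebra.comul_mul, hd.comul_apply, ← (ℛ k h).eq, Finset.sum_mul_sum,
      Finset.sum_product]
    simp
  simp only [LinearMap.compr₂ₛₗ_apply, TensorProduct.mk_apply, LinearMap.comp_apply,
    LinearMap.rTensor_tmul, inducedCoaction_tmul ν (ℛ k h).eq.symm, sum_tmul, map_sum,
    twist_tmul _ (hb _), LinearMap.lTensor_tmul, tmul_sum, BialgHom.id_apply,
    inducedCoaction_tmul ν (hmul _), Finset.sum_product, map_mul]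
  rw [Finset.sum_comm]
  exact Finset.sum_congr rfl fun a _ => Finset.sum_comm

theorem twist_bijective [FiniteDimensional k H] [FiniteDimensional k X] :
    Function.Bijective (twist (BialgHom.id k H) X) := by
  have h := twist_surjective (BialgHom.id k H) (X := X)
  refine ⟨(LinearMap.injective_iff_surjective_of_finrank_eq_finrank (K := k)
    (V := (H ⊗[k] X) ⊗[k] H) (V₂ := H ⊗[k] (X ⊗[k] H)) (f := twist (BialgHom.id k H) X) ?_).2 h, h⟩
  simp only [Module.finrank_tensorProduct]
  ring

end Induced
section Step

variable {H : Type*} [Ring H] [HopfAlgebra k H] [HopfAlgebra k Q] {ν : H →ₐc[k] Q}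

theorem lTensor_prod_surjective {M M' V W : Type*} [AddCommGroup M] [Module k M]
    [AddCommGroup M'] [Module k M'] [AddCommGroup V] [Module k V] [AddCommGroup W] [Module k W]
    (G : M →ₗ[k] Q ⊗[k] M') (g₁ : M' →ₗ[k] V) (g₂ : M' →ₗ[k] W)
    (h₁ : Function.Surjective (g₁.lTensor Q ∘ₗ G))
    (h₂ : Submodule.map (g₂.lTensor Q ∘ₗ G) (LinearMap.ker (g₁.lTensor Q ∘ₗ G)) = ⊤) :
    Function.Surjective ((g₁.prod g₂).lTensor Q ∘ₗ G) := by
  intro z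
  obtain ⟨y, hy⟩ := h₁ (TensorProduct.prodRight k k Q V W z).1
  obtain ⟨w, hw, hw2⟩ := h₂.ge (Submodule.mem_top (x :=
    (TensorProduct.prodRight k k Q V W z).2 - (g₂.lTensor Q ∘ₗ G) y))
  have hp : (TensorProduct.prodRight k k Q V W).toLinearMap ∘ₗ (g₁.prod g₂).lTensor Q =
      (g₁.lTensor Q).prod (g₂.lTensor Q) := by
    ext <;> simp
  refine ⟨y + w, (TensorProduct.prodRight k k Q V W).injective ?_⟩
  refine (LinearMap.congr_fun hp (G (y + w))).trans ?_
  have hw : (g₁.lTensor Q) (G w) = 0 := hw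
  simp only [LinearMap.comp_apply] at hy hw2
  ext1
  · simp [hy, hw]
  · simp [hw2]

theorem IsLeftCoaction.mem_range_lTensor_subtype_ker {M V : Type*} [AddCommGroup M]
    [Module k M] [AddCommGroup V] [Module k V] {ρ : M →ₗ[k] Q ⊗[k] M} (hρ : IsLeftCoaction ρ)
    (f : M →ₗ[k] V) {m : M} (hm : m ∈ LinearMap.ker (f.lTensor Q ∘ₗ ρ)) :
    ρ m ∈ LinearMap.range ((LinearMap.ker (f.lTensor Q ∘ₗ ρ)).subtype.lTensor Q) := by
  have hex := Module.Flat.lTensor_exact Q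
    (LinearMap.exact_subtype_ker_map (f.lTensor Q ∘ₗ ρ))
  refine (hex _).1 ?_
  rw [LinearMap.lTensor_comp_apply, ← hρ.assoc_comul]
  have hc : (f.lTensor Q).lTensor Q ∘ₗ (TensorProduct.assoc k Q Q M).toLinearMap ∘ₗ
      (comul (R := k)).rTensor M = (TensorProduct.assoc k Q Q V).toLinearMap ∘ₗ
      (comul (R := k)).rTensor V ∘ₗ f.lTensor Q := by
    refine TensorProduct.ext' fun q m => ?_
    simp only [LinearMap.comp_apply, LinearMap.rTensor_tmul, LinearMap.lTensor_tmul]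
    generalize comul (R := k) q = t
    induction t with
    | zero => simp
    | add x y hx hy => simp only [add_tmul, map_add, hx, hy]
    | tmul x y => simp
  have hm : f.lTensor Q (ρ m) = 0 := hm
  refine (LinearMap.congr_fun hc (ρ m)).trans ?_
  simp only [LinearMap.comp_apply, hm, map_zero]

theorem IsLeftCoaction.exists_surjective_twist [FiniteDimensional k H] [FiniteDimensional k Q]
    (hν : Function.Surjective ν) {M V : Type*} [AddCommGroup M] [Module k M]
    [FiniteDimensional k M] [AddCommGroup V] [Module k V] {ρ : M →ₗ[k] Q ⊗[k] M}
    (hρ : IsLeftCoaction ρ) (f : M →ₗ[k] V) (hf : Function.Surjective (f.lTensor Q ∘ₗ ρ)) :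
    ∃ g : M ⊗[k] H →ₗ[k] (V ⊗[k] H) × LinearMap.ker (f.lTensor Q ∘ₗ ρ),
      Function.Surjective (g.lTensor Q ∘ₗ twist ν M ∘ₗ ρ.rTensor H) := by
  classical
  obtain ⟨K, hK⟩ : ∃ K, K = LinearMap.ker (f.lTensor Q ∘ₗ ρ) := ⟨_, rfl⟩
  rw [← hK]
  obtain ⟨π, hπ⟩ := LinearMap.exists_leftInverse_of_injective K.subtype (by simp)
  have hπ (x : K) : π x = x := LinearMap.congr_fun hπ x
  let b := Module.finBasis k K
  have hc (j) : ∃ c : _ → Q, ρ (b j) = ∑ i, c i ⊗ₜ[k] (b i : M) := by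
    have hj : (b j : M) ∈ LinearMap.ker (f.lTensor Q ∘ₗ ρ) := hK ▸ (b j).2
    have h := hρ.mem_range_lTensor_subtype_ker f hj
    rw [← hK] at h
    obtain ⟨t, ht⟩ := h
    obtain ⟨c, hc⟩ := TensorProduct.eq_repr_basis_right b t
    refine ⟨c, ?_⟩
    rw [← ht, ← hc, Finsupp.sum_fintype _ _ (by simp)]
    simp
  choose c hc using hc
  have hcc : IsCorepresentation k (Matrix.of c) :=
    hρ.isCorepresentation (b.linearIndependent.map' K.subtype (by simp)) hc
  choose T hT using (LinearMap.injective_iff_surjective.1 (antipode_injective (k := k) (Q := Q)))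
  choose σ hσ using hν
  let g₂ : M ⊗[k] H →ₗ[k] K := TensorProduct.rid k K ∘ₗ TensorProduct.map π (counit (R := k))
  have h1 : (f.rTensor H).lTensor Q ∘ₗ twist ν M ∘ₗ ρ.rTensor H =
      twist ν V ∘ₗ (f.lTensor Q ∘ₗ ρ).rTensor H := by
    rw [← LinearMap.comp_assoc, lTensor_rTensor_comp_twist, LinearMap.comp_assoc,
      ← LinearMap.rTensor_comp]
  have h2 (q : Q) (m : M) (h : H) :
      g₂.lTensor Q (twist ν M ((q ⊗ₜ m) ⊗ₜ h)) = (q * ν h) ⊗ₜ π m := by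
    have h3 : ∑ i ∈ (ℛ k h).index, counit (R := k) ((ℛ k h).right i) • (ℛ k h).left i = h := by
      simpa only [map_sum, TensorProduct.rid_tmul, one_smul] using
        congrArg (TensorProduct.rid k H) (Coalgebra.sum_tmul_counit_eq (R := k) (ℛ k h))
    have h4 := congrArg (fun x => (q * ν x) ⊗ₜ[k] π m) h3
    simp only [map_sum, map_smul, Finset.mul_sum, sum_tmul, mul_smul_comm] at h4
    simp [twist_tmul ν (ℛ k h).eq.symm, g₂, ← h4, smul_tmul]
  refine ⟨(f.rTensor H).prod g₂, lTensor_prod_surjective _ _ _ ?_ ?_⟩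
  · rw [h1]
    exact (twist_surjective ν).comp (LinearMap.rTensor_surjective H hf)
  · rw [eq_top_iff, ← TensorProduct.span_tmul_eq_top, Submodule.span_le]
    rintro _ ⟨q, y, rfl⟩
    rw [← b.sum_repr y]
    simp only [tmul_sum, tmul_smul]
    refine sum_mem fun i _ => Submodule.smul_mem _ _
      ⟨∑ j, (b j : M) ⊗ₜ σ (T (c i j) * q), ?_, ?_⟩
    · have hb (j) : (f.lTensor Q) (ρ (b j)) = 0 := by
        have hj : (b j : M) ∈ LinearMap.ker (f.lTensor Q ∘ₗ ρ) := hK ▸ (b j).2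
        exact hj
      rw [h1]
      simp [hb]
    · simp only [map_sum, LinearMap.comp_apply, LinearMap.rTensor_tmul, hc, sum_tmul, h2, hσ, hπ]
      rw [Finset.sum_comm]
      simp only [← sum_tmul, ← mul_assoc, ← Finset.sum_mul]
      have key := hcc.sum_mul_antipode_inv hT
      simp only [Matrix.of_apply] at key
      simp only [key, ite_mul, one_mul, zero_mul]
      rw [Finset.sum_eq_single i] <;> simp +contextual [eq_comm]

theorem exists_lTensor_comp_inducedCoaction_surjective [FiniteDimensional k H]
    [FiniteDimensional k Q] (hν : Function.Surjective ν) {X V : Type*} [AddCommGroup X] [Module k X]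
    [FiniteDimensional k X] [AddCommGroup V] [Module k V] (f : H ⊗[k] X →ₗ[k] V)
    (hf : Function.Surjective (f.lTensor Q ∘ₗ inducedCoaction ν X)) :
    ∃ g : H ⊗[k] (X ⊗[k] H) →ₗ[k]
        (V ⊗[k] H) × LinearMap.ker (f.lTensor Q ∘ₗ inducedCoaction ν X),
      Function.Surjective (g.lTensor Q ∘ₗ inducedCoaction ν (X ⊗[k] H)) := by
  obtain ⟨g, hg⟩ := (isLeftCoaction_inducedCoaction ν (X := X)).exists_surjective_twist hν f hf
  let e := LinearEquiv.ofBijective (twist (BialgHom.id k H) X) twist_bijective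
  have he : e.toLinearMap = twist (BialgHom.id k H) X := rfl
  refine ⟨g ∘ₗ e.symm.toLinearMap, ?_⟩
  have h : ((g ∘ₗ e.symm.toLinearMap).lTensor Q ∘ₗ inducedCoaction ν (X ⊗[k] H)) ∘ₗ e.toLinearMap =
      g.lTensor Q ∘ₗ twist ν (H ⊗[k] X) ∘ₗ (inducedCoaction ν X).rTensor H := by
    rw [he, LinearMap.comp_assoc, inducedCoaction_comp_twist, ← he, ← LinearMap.comp_assoc,
      ← LinearMap.lTensor_comp, LinearMap.comp_assoc, LinearEquiv.symm_comp, LinearMap.comp_id]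
  rw [← h] at hg
  exact Function.Surjective.of_comp hg

/-- The free left `Q`-comodule of rank `a` is a quotient of `H ⊗ k^u`. -/
def HasFreeQuotient (ν : H →ₐc[k] Q) (u a : ℕ) : Prop :=
  ∃ f : H ⊗[k] (Fin u → k) →ₗ[k] (Fin a → k),
    Function.Surjective (f.lTensor Q ∘ₗ inducedCoaction ν (Fin u → k))

theorem lTensor_lTensor_comp_inducedCoaction {X Y : Type*} [AddCommGroup X] [Module k X]
    [AddCommGroup Y] [Module k Y] (f : X →ₗ[k] Y) :
    (f.lTensor H).lTensor Q ∘ₗ inducedCoaction ν X = inducedCoaction ν Y ∘ₗ f.lTensor H := by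
  ext h x
  simp [inducedCoaction_tmul ν (ℛ k h).eq.symm]

theorem hasFreeQuotient_of_surjective {X V : Type*} [AddCommGroup X] [Module k X]
    [AddCommMonoid V] [Module k V] {u a : ℕ} (f : H ⊗[k] X →ₗ[k] V)
    (hf : Function.Surjective (f.lTensor Q ∘ₗ inducedCoaction ν X))
    (eX : (Fin u → k) ≃ₗ[k] X) (eV : V ≃ₗ[k] (Fin a → k)) : HasFreeQuotient ν u a := by
  refine ⟨eV.toLinearMap ∘ₗ f ∘ₗ eX.toLinearMap.lTensor H, ?_⟩
  rw [LinearMap.lTensor_comp, LinearMap.lTensor_comp, LinearMap.comp_assoc, LinearMap.comp_assoc,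
    lTensor_lTensor_comp_inducedCoaction, ← LinearMap.comp_assoc _ _ (f.lTensor Q)]
  exact (LinearMap.lTensor_surjective Q eV.surjective).comp
    (hf.comp (LinearMap.lTensor_surjective H eX.surjective))

theorem finrank_ker_lTensor_comp [FiniteDimensional k H] [FiniteDimensional k Q] {X V : Type*}
    [AddCommGroup X] [Module k X] [FiniteDimensional k X] [AddCommGroup V] [Module k V]
    (f : H ⊗[k] X →ₗ[k] V) (hf : Function.Surjective (f.lTensor Q ∘ₗ inducedCoaction ν X)) {K : ℕ}
    (hK : Module.finrank k Q * Module.finrank k V + K =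
      Module.finrank k H * Module.finrank k X) :
    Module.finrank k (LinearMap.ker (f.lTensor Q ∘ₗ inducedCoaction ν X)) = K := by
  have h := LinearMap.finrank_range_add_finrank_ker (f.lTensor Q ∘ₗ inducedCoaction ν X)
  rw [LinearMap.range_eq_top.2 hf, finrank_top, Module.finrank_tensorProduct,
    Module.finrank_tensorProduct, ← hK] at h
  exact Nat.add_left_cancel h

theorem nonempty_prod_submodule_equiv {A M : Type*} [AddCommGroup A] [Module k A]
    [FiniteDimensional k A] [AddCommGroup M] [Module k M] [FiniteDimensional k M]
    (W : Submodule k M) {n : ℕ} (h : Module.finrank k A + Module.finrank k W = n) :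
    Nonempty ((A × W) ≃ₗ[k] (Fin n → k)) :=
  ⟨LinearEquiv.ofFinrankEq _ _ (by rw [Module.finrank_prod, h, Module.finrank_fin_fun])⟩

theorem hasFreeQuotient_mul_finrank [FiniteDimensional k H] [FiniteDimensional k Q]
    (hν : Function.Surjective ν) {X V : Type*} [AddCommGroup X] [Module k X]
    [FiniteDimensional k X] [AddCommGroup V] [Module k V] [FiniteDimensional k V]
    (f : H ⊗[k] X →ₗ[k] V) (hf : Function.Surjective (f.lTensor Q ∘ₗ inducedCoaction ν X)) {K : ℕ}
    (hK : Module.finrank k Q * Module.finrank k V + K =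
      Module.finrank k H * Module.finrank k X) :
    HasFreeQuotient ν (Module.finrank k X * Module.finrank k H)
      (Module.finrank k V * Module.finrank k H + K) := by
  obtain ⟨g, hg⟩ := exists_lTensor_comp_inducedCoaction_surjective hν f hf
  have h₁ : Module.finrank k (X ⊗[k] H) = Module.finrank k X * Module.finrank k H :=
    Module.finrank_tensorProduct ..
  obtain ⟨e⟩ := nonempty_prod_submodule_equiv (A := V ⊗[k] H)
    (LinearMap.ker (f.lTensor Q ∘ₗ inducedCoaction ν X))
    (n := Module.finrank k V * Module.finrank k H + K)
    (by rw [Module.finrank_tensorProduct, finrank_ker_lTensor_comp f hf hK])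
  exact hasFreeQuotient_of_surjective g hg (LinearEquiv.ofFinrankEq _ _ (by simp [h₁])) e

theorem HasFreeQuotient.mul_finrank [FiniteDimensional k H] [FiniteDimensional k Q]
    (hν : Function.Surjective ν) {u a K : ℕ} (h : HasFreeQuotient ν u a)
    (hK : Module.finrank k Q * a + K = Module.finrank k H * u) :
    HasFreeQuotient ν (u * Module.finrank k H) (a * Module.finrank k H + K) := by
  obtain ⟨f, hf⟩ := h
  simpa using hasFreeQuotient_mul_finrank hν f hf (K := K) (by simpa using hK)

theorem exists_hasFreeQuotient [FiniteDimensional k H] [FiniteDimensional k Q]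
    (hν : Function.Surjective ν) (n : ℕ) :
    ∃ a : ℕ, HasFreeQuotient ν (Module.finrank k H ^ n) a ∧
      Module.finrank k Q * a + Module.finrank k H * (Module.finrank k H - Module.finrank k Q) ^ n =
        Module.finrank k H * Module.finrank k H ^ n := by
  have hle : Module.finrank k Q ≤ Module.finrank k H :=
    LinearMap.finrank_le_finrank_of_surjective (f := (ν : H →ₗ[k] Q)) hν
  obtain ⟨c, hc⟩ := Nat.exists_eq_add_of_le hle
  induction n with
  | zero => exact ⟨0, ⟨0, fun x => ⟨0, Subsingleton.elim _ _⟩⟩, by simp⟩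
  | succ n ih =>
    obtain ⟨a, ha, h⟩ := ih
    refine ⟨_, ha.mul_finrank hν h, ?_⟩
    rw [hc] at h ⊢
    simp only [add_tsub_cancel_left] at h ⊢
    linear_combination (Module.finrank k Q + c) * h

theorem finrank_range_rTensor {M N X : Type*} [AddCommGroup M] [Module k M] [AddCommGroup N]
    [Module k N] [AddCommGroup X] [Module k X] (f : M →ₗ[k] N) :
    Module.finrank k (LinearMap.range (f.rTensor X)) =
      Module.finrank k (LinearMap.range f) * Module.finrank k X := by
  have h : f.rTensor X = (LinearMap.range f).subtype.rTensor X ∘ₗ f.rangeRestrict.rTensor X := by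
    rw [← LinearMap.rTensor_comp, LinearMap.subtype_comp_codRestrict]
  rw [h, LinearMap.range_comp_of_range_eq_top _ (LinearMap.range_eq_top.2
      (LinearMap.rTensor_surjective X f.surjective_rangeRestrict)),
    LinearMap.finrank_range_of_inj
      (Module.Flat.rTensor_preserves_injective_linearMap _ (Submodule.subtype_injective _)),
    Module.finrank_tensorProduct]

theorem finrank_le_finrank_map_add_finrank_ker {M N : Type*} [AddCommGroup M] [Module k M]
    [FiniteDimensional k M] [AddCommGroup N] [Module k N] (f : M →ₗ[k] N) (R : Submodule k M) :
    Module.finrank k R ≤ Module.finrank k (R.map f) + Module.finrank k (LinearMap.ker f) := by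
  rw [← LinearMap.finrank_range_add_finrank_ker (f.domRestrict R), LinearMap.range_domRestrict]
  refine Nat.add_le_add_left (LinearMap.finrank_le_finrank_of_injective
    (f := R.subtype.restrict (p := LinearMap.ker (f.domRestrict R)) (q := LinearMap.ker f)
      fun x hx => hx) fun x y hxy => ?_) _
  exact Subtype.ext (Subtype.ext (congrArg (fun z : LinearMap.ker f => (z : M)) hxy))

/-- The endomorphism `h ↦ l(ν(h₁)) h₂` of `H`. -/
noncomputable def contractAlong (ν : H →ₐc[k] Q) (l : Q →ₗ[k] k) : H →ₗ[k] H :=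
  TensorProduct.lid k H ∘ₗ (l ∘ₗ (ν : H →ₗ[k] Q)).rTensor H ∘ₗ comul (R := k)

theorem inducedCoaction_comp_contractAlong [FiniteDimensional k H] {l : Q →ₗ[k] k}
    (hl : IsRightIntegral l) {X : Type*} [AddCommGroup X] [Module k X] :
    inducedCoaction ν X ∘ₗ (contractAlong ν l).rTensor X =
      ((LinearMap.toSpanSingleton k Q 1) ∘ₗ l).rTensor (H ⊗[k] X) ∘ₗ inducedCoaction ν X := by
  classical
  let b := Module.finBasis k H
  obtain ⟨d, hd, hb⟩ := exists_corepresentation_basis b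
  refine TensorProduct.ext (b.ext fun j => LinearMap.ext fun x => ?_)
  have hL : contractAlong ν l (b j) = ∑ i, l (ν (d j i)) • b i := by
    simp [contractAlong, hb]
  have hi (m) : ∑ i, l (ν (d j i)) • ν (d i m) = l (ν (d j m)) • 1 := by
    rw [← hl (ν (d j m)), ← CoalgHomClass.map_comp_comul_apply, hd.comul_apply]
    simp
  simp only [LinearMap.compr₂ₛₗ_apply, TensorProduct.mk_apply, LinearMap.comp_apply,
    LinearMap.rTensor_tmul, hL, sum_tmul, map_sum, inducedCoaction_tmul ν (hb _),
    ← smul_tmul', map_smul, LinearMap.toSpanSingleton_apply, Finset.smul_sum]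
  rw [Finset.sum_comm]
  simp only [smul_tmul', ← sum_tmul, hi]

theorem HasFreeQuotient.bounds [FiniteDimensional k H] [FiniteDimensional k Q] [Nontrivial Q]
    {l : Q →ₗ[k] k} (hl : IsRightIntegral l) (hl0 : l ≠ 0) {u a K : ℕ} (h : HasFreeQuotient ν u a)
    (hK : Module.finrank k Q * a + K = Module.finrank k H * u) :
    a ≤ Module.finrank k (LinearMap.range (contractAlong ν l)) * u ∧
      Module.finrank k (LinearMap.range (contractAlong ν l)) * u ≤ a + K := by
  obtain ⟨f, hf⟩ := h
  have hker := finrank_ker_lTensor_comp f hf (K := K) (by simpa using hK)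
  have hR := finrank_range_rTensor (X := Fin u → k) (contractAlong ν l)
  have hP : Module.finrank k (LinearMap.range
      (((LinearMap.toSpanSingleton k Q 1) ∘ₗ l).rTensor (Fin a → k))) = a := by
    rw [finrank_range_rTensor, LinearMap.range_comp_of_range_eq_top _
      (LinearMap.range_eq_top.2 (LinearMap.surjective hl0)), LinearMap.range_toSpanSingleton,
      finrank_span_singleton one_ne_zero, Module.finrank_fin_fun, one_mul]
  have hmap : (LinearMap.range ((contractAlong ν l).rTensor (Fin u → k))).map
      (f.lTensor Q ∘ₗ inducedCoaction ν (Fin u → k)) =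
      LinearMap.range (((LinearMap.toSpanSingleton k Q 1) ∘ₗ l).rTensor (Fin a → k)) := by
    rw [← LinearMap.range_comp, LinearMap.comp_assoc, inducedCoaction_comp_contractAlong hl,
      ← LinearMap.comp_assoc, LinearMap.lTensor_comp_rTensor, ← LinearMap.rTensor_comp_lTensor,
      LinearMap.comp_assoc, LinearMap.range_comp_of_range_eq_top _ (LinearMap.range_eq_top.2 hf)]
  rw [Module.finrank_fin_fun] at hR
  rw [← hR]
  have h₁ := Submodule.finrank_map_le (f.lTensor Q ∘ₗ inducedCoaction ν (Fin u → k))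
    (LinearMap.range ((contractAlong ν l).rTensor (Fin u → k)))
  have h₂ := finrank_le_finrank_map_add_finrank_ker (f.lTensor Q ∘ₗ inducedCoaction ν (Fin u → k))
    (LinearMap.range ((contractAlong ν l).rTensor (Fin u → k)))
  rw [hmap, hP] at h₁ h₂
  rw [hker] at h₂
  exact ⟨h₁, h₂⟩

theorem finrank_dvd_of_surjective [FiniteDimensional k H] [FiniteDimensional k Q] [Nontrivial Q]
    (hν : Function.Surjective ν) : Module.finrank k Q ∣ Module.finrank k H := by
  obtain ⟨l, hl, hl0⟩ := exists_isRightIntegral_ne_zero (k := k) (Q := Q)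
  have hle : Module.finrank k Q ≤ Module.finrank k H :=
    LinearMap.finrank_le_finrank_of_surjective (f := (ν : H →ₗ[k] Q)) hν
  have hd : 0 < Module.finrank k Q := Module.finrank_pos
  have hn (n : ℕ) := exists_hasFreeQuotient hν n
  refine ⟨Module.finrank k (LinearMap.range (contractAlong ν l)), ?_⟩
  have hb (n : ℕ) : ∃ a, _ ∧ _ ∧ _ :=
    (hn n).imp fun a ha => ⟨ha.2, ha.1.bounds hl hl0 ha.2⟩
  generalize Module.finrank k (LinearMap.range (contractAlong ν l)) = r at hb ⊢
  generalize Module.finrank k Q = d at *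
  generalize Module.finrank k H = N at *
  by_contra hne
  have key (n : ℕ) : N ^ n ≤ d * N * (N - d) ^ n := by
    obtain ⟨a, h1, h2, h3⟩ := hb n
    have h2 := Nat.mul_le_mul_left d h2
    have h3 := Nat.mul_le_mul_left d h3
    generalize (N - d) ^ n = z at *
    generalize N ^ n = u at *
    have hz : N * z ≤ d * N * z := by nlinarith [Nat.zero_le (N * z)]
    rcases Nat.lt_or_gt_of_ne hne with h | h <;> nlinarith
  have hN : (0 : ℝ) < N := by exact_mod_cast hd.trans_le hle
  have hd' : (0 : ℝ) < d := by exact_mod_cast hd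
  obtain ⟨n, hn⟩ := exists_pow_lt_of_lt_one (x := (1 / (d * N) : ℝ)) (y := (N - d) / N)
    (by positivity) (by rw [div_lt_one hN]; linarith)
  have h := key n
  rify [hle] at h
  rw [div_pow, div_lt_div_iff₀ (by positivity) (by positivity)] at hn
  linarith

end Step

end Corepresentation

/-- (Lagrange for quotients, ordinary Hopf case.)
If `H` is a finite-dimensional Hopf algebra over a field `k` and `Q = H/I` is a quotient
bialgebra of `H` (presented by a surjective bialgebra map `ν : H → Q` whose kernel `I`
satisfies `S(I) ⊆ I`), then `dim Q` divides `dim H`. -/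
theorem finrank_quotient_bialgebra_dvd_finrank
    {k : Type*} [Field k] {H Q : Type*} [Ring H] [HopfAlgebra k H] [Ring Q] [Bialgebra k Q]
    [FiniteDimensional k H] (ν : H →ₐc[k] Q) (hν : Function.Surjective ν)
    (hS : ∀ h : H, ν h = 0 → ν (HopfAlgebra.antipode (R := k) h) = 0) :
    Module.finrank k Q ∣ Module.finrank k H := by
  obtain ⟨σ, hσ⟩ := LinearMap.exists_rightInverse_of_surjective (ν : H →ₗ[k] Q)
    (LinearMap.range_eq_top.2 hν)
  have hσ (q : Q) : ν (σ q) = q := LinearMap.congr_fun hσ q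
  let : HopfAlgebraStruct k Q :=
    { antipode := (ν : H →ₗ[k] Q) ∘ₗ antipode k ∘ₗ σ }
  let : HopfAlgebra k Q := HopfAlgebra.ofSurjective ν hν <| LinearMap.ext fun h => by
    have h0 := hS (σ (ν h) - h) (by rw [map_sub, hσ, sub_self])
    rw [map_sub, map_sub, sub_eq_zero] at h0
    exact h0
  have : FiniteDimensional k Q := Module.Finite.of_surjective (ν : H →ₗ[k] Q) hν
  have : Nontrivial Q := by
    refine ⟨1, 0, fun h => one_ne_zero (α := k) ?_⟩
    rw [← Bialgebra.counit_one (R := k) (A := Q), h, map_zero]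
  exact finrank_dvd_of_surjective (ν := ν) hν
end

section
/- Let H be a finite-dimensional Hopf algebra over a field k. Then the number of grouplike elements of the dual Hopf algebra H* (equivalently, the number of one-dimensional representations of H, i.e., algebra maps H → k) divides dim H. -/
open TensorProduct Module

namespace Representation

section Basic

variable {k G V W : Type*} [Field k] [Group G] [AddCommGroup V] [Module k V]
  [AddCommGroup W] [Module k W]

lemma finrank_invariants_congr {ρ : Representation k G V} {σ : Representation k G W}
    (e : V ≃ₗ[k] W) (he : ∀ g, e.toLinearMap ∘ₗ ρ g = σ g ∘ₗ e.toLinearMap) :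
    finrank k ρ.invariants = finrank k σ.invariants := by
  have he' : ∀ g v, e (ρ g v) = σ g (e v) := fun g v => LinearMap.congr_fun (he g) v
  have hmap : ρ.invariants.map e.toLinearMap = σ.invariants := by
    ext w
    obtain ⟨v, rfl⟩ := e.surjective w
    simp [mem_invariants, ← he']
  rw [← hmap]
  exact (e.submoduleMap ρ.invariants).finrank_eq

/-- Tensoring with a trivial representation multiplies the dimension of the invariants. -/
lemma finrank_invariants_tprod_trivial (ρ : Representation k G V) [FiniteDimensional k W]
    [FiniteDimensional k V] :
    finrank k (ρ.tprod (trivial k G W)).invariants = finrank k W * finrank k ρ.invariants := by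
  let b := finBasis k W
  let e : V ⊗[k] W ≃ₗ[k] (Fin (finrank k W) → V) :=
    TensorProduct.equivFinsuppOfBasisRight b ≪≫ₗ Finsupp.linearEquivFunOnFinite k V _
  have he : ∀ g x i, e ((ρ.tprod (trivial k G W)) g x) i = ρ g (e x i) := by
    intro g x i
    induction x with
    | zero => simp
    | tmul v w => simp [e]
    | add x y hx hy => simp only [map_add, Pi.add_apply, hx, hy]
  have hinv : ∀ x, x ∈ (ρ.tprod (trivial k G W)).invariants ↔ ∀ i, e x i ∈ ρ.invariants := by
    intro x
    simp only [mem_invariants, ← he]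
    rw [forall_comm]
    refine forall_congr' fun g => ?_
    rw [← e.injective.eq_iff, funext_iff]
  let e' : (ρ.tprod (trivial k G W)).invariants ≃ₗ[k] (Fin (finrank k W) → ρ.invariants) :=
    { toFun := fun x i => ⟨e x i, (hinv x).1 x.2 i⟩
      map_add' := fun x y => by ext; simp
      map_smul' := fun c x => by ext; simp
      invFun := fun f => ⟨e.symm fun i => f i, (hinv _).2 fun i => by simp⟩
      left_inv := fun x => by simp
      right_inv := fun f => by ext; simp }
  rw [e'.finrank_eq, finrank_pi_fintype]
  simp

end Basic

section Orbit

variable {k G H W : Type*} [Field k] [Group G] [AddCommGroup H] [Module k H]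
  [AddCommGroup W] [Module k W]

/-- The map to functions on `G` attached to a linear functional on a representation. -/
def orbitMap (ρ : Representation k G H) (ε : H →ₗ[k] k) : H →ₗ[k] (G → k) :=
  LinearMap.pi fun g => ε ∘ₗ ρ g

@[simp]
lemma orbitMap_apply (ρ : Representation k G H) (ε : H →ₗ[k] k) (h : H) (g : G) :
    ρ.orbitMap ε h g = ε (ρ g h) := rfl

/-- The kernel of `orbitMap`, the largest subrepresentation on which `ε` vanishes. -/
def orbitKer (ρ : Representation k G H) (ε : H →ₗ[k] k) :
    Representation k G (LinearMap.ker (ρ.orbitMap ε)) :=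
  ρ.subrepresentation _ fun g h hh => by
    have hh' : ∀ x, ε (ρ x h) = 0 := fun x => congrFun hh x
    ext x
    simpa using hh' (x * g)

lemma orbitKer_coe (ρ : Representation k G H) (ε : H →ₗ[k] k) (g : G)
    (x : LinearMap.ker (ρ.orbitMap ε)) : (ρ.orbitKer ε g x : H) = ρ g x := rfl

lemma orbitMap_surjective [Finite G] (ρ : Representation k G H) (ε : H →ₗ[k] k) (h₀ : H)
    (h₁ : ε h₀ = 1) (h₂ : ∀ g, g ≠ 1 → ε (ρ g h₀) = 0) :
    Function.Surjective (ρ.orbitMap ε) := by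
  classical
  have := Fintype.ofFinite G
  intro f
  refine ⟨∑ g, f g • ρ g⁻¹ h₀, ?_⟩
  ext x
  simp only [orbitMap_apply, map_sum, map_smul, smul_eq_mul]
  rw [Finset.sum_eq_single x]
  · simp [h₁]
  · intro g _ hg
    rw [← Module.End.mul_apply, ← map_mul, h₂ _ (by simpa [mul_inv_eq_one] using hg.symm), mul_zero]
  · simp

lemma finrank_orbitKer [Finite G] [FiniteDimensional k H] (ρ : Representation k G H)
    (ε : H →ₗ[k] k) (h : Function.Surjective (ρ.orbitMap ε)) :
    Nat.card G + finrank k (LinearMap.ker (ρ.orbitMap ε)) = finrank k H := by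
  have := Fintype.ofFinite G
  rw [← (ρ.orbitMap ε).finrank_range_add_finrank_ker, LinearMap.range_eq_top.2 h]
  simp

/-- The invariants of `H ⊗ W` are those of `ker ⊗ W` together with those of the free part. -/
lemma finrank_invariants_tprod_orbitKer [Finite G] [FiniteDimensional k H] [FiniteDimensional k W]
    (ρ : Representation k G H) (ε : H →ₗ[k] k) (h₀ : H)
    (h₁ : ε h₀ = 1) (h₂ : ∀ g, g ≠ 1 → ε (ρ g h₀) = 0) (σ : Representation k G W) :
    finrank k (ρ.tprod σ).invariants =
      finrank k W + finrank k ((ρ.orbitKer ε).tprod σ).invariants := by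
  classical
  have := Fintype.ofFinite G
  set E := LinearMap.ker (ρ.orbitMap ε)
  let π : H ⊗[k] W →ₗ[k] W := _root_.TensorProduct.lid k W ∘ₗ ε.rTensor W
  let ι : E ⊗[k] W →ₗ[k] H ⊗[k] W := E.subtype.rTensor W
  have hι : Function.Injective ι :=
    Module.Flat.rTensor_preserves_injective_linearMap _ E.injective_subtype
  have hιg : ∀ g x, ι (((ρ.orbitKer ε).tprod σ) g x) = (ρ.tprod σ) g (ι x) := by
    intro g x
    induction x with
    | zero => simp
    | tmul v w => simp [ι, orbitKer_coe]
    | add x y hx hy => simp only [map_add, hx, hy]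
  have hπg : ∀ g h w, π ((ρ.tprod σ) g (h ⊗ₜ w)) = ε (ρ g h) • σ g w := by
    intro g h w
    simp [π]
  let φ : (ρ.tprod σ).invariants →ₗ[k] W := π.domRestrict _
  have hφ : Function.Surjective φ := by
    intro w
    refine ⟨⟨∑ g, (ρ.tprod σ) g (h₀ ⊗ₜ w), fun g => ?_⟩, ?_⟩
    · rw [map_sum]
      simp_rw [← Module.End.mul_apply, ← map_mul]
      exact Fintype.sum_equiv (Equiv.mulLeft g) _ _ fun _ => rfl
    · simp only [φ, LinearMap.domRestrict_apply, map_sum, hπg]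
      rw [Finset.sum_eq_single 1]
      · simp [h₁]
      · intro g _ hg
        rw [h₂ g hg, zero_smul]
      · simp
  have hrange : ∀ x, x ∈ LinearMap.range ι ↔ ∀ g, π ((ρ.tprod σ) g x) = 0 := by
    intro x
    have hex : Function.Exact ι ((ρ.orbitMap ε).rTensor W) :=
      Module.Flat.rTensor_exact W (LinearMap.exact_subtype_ker_map _)
    have key : ∀ g x, π ((ρ.tprod σ) g x) = σ g
        (_root_.TensorProduct.lid k W ((LinearMap.proj g).rTensor W ((ρ.orbitMap ε).rTensor W x))) := by
      intro g x
      induction x with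
      | zero => simp
      | tmul v w => simp [π]
      | add x y hx hy => simp only [map_add, hx, hy]
    constructor
    · rintro ⟨y, rfl⟩ g
      rw [key, hex.apply_apply_eq_zero]
      simp
    · intro hx
      refine (hex x).1 ?_
      apply (TensorProduct.piLeft k W fun _ : G => k).injective
      ext1 g
      have hpi : ∀ y, TensorProduct.piLeft k W (fun _ : G => k) y g =
          (LinearMap.proj g : (G → k) →ₗ[k] k).rTensor W y := by
        intro y
        induction y with
        | zero => simp
        | tmul v w => simp
        | add x y hx hy => simp only [map_add, Pi.add_apply, hx, hy]
      have hg := hx g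
      rw [key, map_eq_zero_iff _ (σ.apply_bijective g).1,
        map_eq_zero_iff _ (_root_.TensorProduct.lid k W).injective] at hg
      rw [hpi, hg, map_zero, Pi.zero_apply]
  have hker : finrank k (LinearMap.ker φ) =
      finrank k ((ρ.orbitKer ε).tprod σ).invariants := by
    have hmap : ((ρ.orbitKer ε).tprod σ).invariants.map ι =
        (LinearMap.ker φ).map (ρ.tprod σ).invariants.subtype := by
      ext x
      simp only [Submodule.mem_map, LinearMap.mem_ker, Submodule.subtype_apply]
      constructor
      · rintro ⟨y, hy, rfl⟩
        have hy' : ι y ∈ (ρ.tprod σ).invariants := fun g => by rw [← hιg, hy g]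
        refine ⟨⟨ι y, hy'⟩, ?_, rfl⟩
        have := (hrange (ι y)).1 ⟨y, rfl⟩ 1
        simpa [φ] using this
      · rintro ⟨y, hy, rfl⟩
        obtain ⟨z, hz⟩ := (hrange y).2 fun g => by rw [y.2 g]; exact hy
        exact ⟨z, fun g => hι (by rw [hιg, hz, y.2 g]), hz⟩
    rw [← Submodule.finrank_map_subtype_eq, ← hmap]
    exact (Submodule.equivMapOfInjective ι hι _).finrank_eq.symm
  rw [← φ.finrank_range_add_finrank_ker, LinearMap.range_eq_top.2 hφ, finrank_top, hker]

end Orbit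

section Shear

universe u v

variable {k : Type u} {G : Type*} {H : Type v} [Field k] [Group G] [AddCommGroup H] [Module k H]
  [FiniteDimensional k H]

lemma finrank_invariants_tprod_tprod {V : Type*} [AddCommGroup V] [Module k V]
    [FiniteDimensional k V] (ρ : Representation k G H)
    (Φ : H ⊗[k] H ≃ₗ[k] H ⊗[k] H)
    (hΦ : ∀ g, Φ.toLinearMap ∘ₗ ρ.tprod ρ g = ρ.tprod (trivial k G H) g ∘ₗ Φ.toLinearMap)
    (σ : Representation k G V) :
    finrank k (ρ.tprod (ρ.tprod σ)).invariants =
      finrank k H * finrank k (ρ.tprod σ).invariants := by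
  rw [← finrank_invariants_tprod_trivial (W := H) (ρ.tprod σ)]
  refine finrank_invariants_congr ((_root_.TensorProduct.assoc k H H V).symm ≪≫ₗ
    LinearEquiv.rTensor V Φ ≪≫ₗ TensorProduct.rightComm k H H V) fun g => ?_
  ext a b v
  have hr : ∀ (x : H ⊗[k] H) (w : V), TensorProduct.rightComm k H H V
      (ρ.tprod (trivial k G H) g x ⊗ₜ σ g w) =
        ((ρ.tprod σ).tprod (trivial k G H)) g (TensorProduct.rightComm k H H V (x ⊗ₜ w)) := by
    intro x w
    induction x with
    | zero => simp
    | tmul a b => simp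
    | add x y hx hy => simp only [map_add, TensorProduct.add_tmul, hx, hy]
  have := LinearMap.congr_fun (hΦ g) (a ⊗ₜ b)
  simp only [LinearMap.comp_apply, LinearEquiv.coe_coe, tprod_apply,
    TensorProduct.map_tmul] at this
  simpa [this] using hr (Φ (a ⊗ₜ b)) v

omit [FiniteDimensional k H] in
lemma finrank_invariants_tprod_left_comm {V W : Type*} [AddCommGroup V] [Module k V]
    [AddCommGroup W] [Module k W] (ρ : Representation k G H) (τ : Representation k G W)
    (σ : Representation k G V) :
    finrank k (ρ.tprod (τ.tprod σ)).invariants = finrank k (τ.tprod (ρ.tprod σ)).invariants := by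
  refine finrank_invariants_congr (TensorProduct.leftComm k H W V) fun g => ?_
  ext a b v
  simp

/-- The failure of the invariants of `H ⊗ V` to have the dimension they have when `H` is free. -/
noncomputable def freeDefect (ρ : Representation k G H) {V : Type*} [AddCommGroup V] [Module k V]
    (σ : Representation k G V) : ℤ :=
  Nat.card G * finrank k (ρ.tprod σ).invariants - finrank k H * finrank k V

lemma abs_freeDefect_le {V : Type*} [AddCommGroup V] [Module k V] [FiniteDimensional k V]
    (ρ : Representation k G H) (σ : Representation k G V) :
    |ρ.freeDefect σ| ≤ (Nat.card G + 1) * finrank k H * finrank k V := by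
  have h : finrank k (ρ.tprod σ).invariants ≤ finrank k H * finrank k V := by
    simpa using (ρ.tprod σ).invariants.finrank_le
  zify at h
  rw [freeDefect, abs_le]
  constructor <;> nlinarith [Int.natCast_nonneg (Nat.card G),
    mul_le_mul_of_nonneg_left h (Int.natCast_nonneg (Nat.card G)),
    mul_nonneg (Int.natCast_nonneg (Nat.card G))
      (Int.natCast_nonneg (finrank k (ρ.tprod σ).invariants))]

variable [Finite G] (ρ : Representation k G H) (ε : H →ₗ[k] k) (h₀ : H)
    (h₁ : ε h₀ = 1) (h₂ : ∀ g, g ≠ 1 → ε (ρ g h₀) = 0)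
    (Φ : H ⊗[k] H ≃ₗ[k] H ⊗[k] H)
    (hΦ : ∀ g, Φ.toLinearMap ∘ₗ ρ.tprod ρ g = ρ.tprod (trivial k G H) g ∘ₗ Φ.toLinearMap)
include h₁ h₂ hΦ

lemma freeDefect_orbitKer_tprod {V : Type*} [AddCommGroup V] [Module k V] [FiniteDimensional k V]
    (σ : Representation k G V) :
    ρ.freeDefect ((ρ.orbitKer ε).tprod σ) = finrank k H * ρ.freeDefect σ := by
  have hd := ρ.finrank_orbitKer ε (ρ.orbitMap_surjective ε h₀ h₁ h₂)
  have hz := ρ.finrank_invariants_tprod_orbitKer ε h₀ h₁ h₂ (ρ.tprod σ)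
  rw [finrank_invariants_tprod_tprod ρ Φ hΦ, ← finrank_invariants_tprod_left_comm,
    finrank_tensorProduct] at hz
  simp only [freeDefect, finrank_tensorProduct]
  zify at hd hz ⊢
  linear_combination (-Nat.card G : ℤ) * hz - (finrank k H * finrank k V : ℤ) * hd

lemma pow_mul_abs_freeDefect_le (n : ℕ) {V : Type v} [AddCommGroup V] [Module k V]
    [FiniteDimensional k V] (σ : Representation k G V) :
    (finrank k H : ℤ) ^ n * |ρ.freeDefect σ| ≤ (Nat.card G + 1) * finrank k H *
      (finrank k (LinearMap.ker (ρ.orbitMap ε)) ^ n * finrank k V) := by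
  induction n generalizing V with
  | zero => simpa using ρ.abs_freeDefect_le σ
  | succ n ih =>
    have := ih ((ρ.orbitKer ε).tprod σ)
    rw [freeDefect_orbitKer_tprod ρ ε h₀ h₁ h₂ Φ hΦ, abs_mul, Nat.abs_cast, finrank_tensorProduct,
      Nat.cast_mul] at this
    convert! this using 1 <;> ring

lemma freeDefect_eq_zero {V : Type v} [AddCommGroup V] [Module k V]
    [FiniteDimensional k V] (σ : Representation k G V) : ρ.freeDefect σ = 0 := by
  have hd := ρ.finrank_orbitKer ε (ρ.orbitMap_surjective ε h₀ h₁ h₂)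
  have hG : 0 < Nat.card G := Nat.card_pos
  set d := finrank k H
  set e := finrank k (LinearMap.ker (ρ.orbitMap ε))
  have hd₀ : (0 : ℝ) < d := by exact_mod_cast (by lia : 0 < d)
  have hlim : Filter.Tendsto (fun n : ℕ => ((Nat.card G + 1) * d * finrank k V : ℝ) * (e / d) ^ n)
      Filter.atTop (nhds 0) := by
    rw [← mul_zero ((Nat.card G + 1) * d * finrank k V : ℝ)]
    refine (tendsto_pow_atTop_nhds_zero_of_lt_one (by positivity) ?_).const_mul _
    rw [div_lt_one hd₀]
    exact_mod_cast (by lia : e < d)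
  have hle : |(ρ.freeDefect σ : ℝ)| ≤ 0 := by
    refine ge_of_tendsto' hlim fun n => ?_
    have := pow_mul_abs_freeDefect_le ρ ε h₀ h₁ h₂ Φ hΦ n σ
    rw [div_pow, mul_div_assoc', le_div_iff₀ (by positivity)]
    have h' : (d : ℝ) ^ n * |(ρ.freeDefect σ : ℝ)| ≤ (Nat.card G + 1) * d *
      (e ^ n * finrank k V) := by exact_mod_cast this
    linarith
  exact_mod_cast abs_nonpos_iff.1 hle

/-- The dimension formula for `H` as a free module over the group algebra of `G`. -/
theorem card_mul_finrank_invariants_eq :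
    Nat.card G * finrank k ρ.invariants = finrank k H := by
  have hd := ρ.finrank_orbitKer ε (ρ.orbitMap_surjective ε h₀ h₁ h₂)
  have hG : 0 < Nat.card G := Nat.card_pos
  have h := freeDefect_eq_zero ρ ε h₀ h₁ h₂ Φ hΦ (trivial k G H)
  rw [freeDefect, finrank_invariants_tprod_trivial, sub_eq_zero] at h
  refine Nat.eq_of_mul_eq_mul_left (by lia : 0 < finrank k H) ?_
  zify
  push_cast at h
  linear_combination h

end Shear
end Representation

namespace HopfAlgebra

open Coalgebra Bialgebra

variable {k H : Type*} [Field k] [Ring H] [HopfAlgebra k H]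

section Shear

variable (k H)

/-- The Galois map `a ⊗ b ↦ a b₍₁₎ ⊗ b₍₂₎`. -/
noncomputable def galoisMap : H ⊗[k] H →ₗ[k] H ⊗[k] H :=
  (LinearMap.mul' k H).rTensor H ∘ₗ (TensorProduct.assoc k H H H).symm.toLinearMap ∘ₗ
    comul.lTensor H

variable {k H}

lemma galoisMap_tmul (a b : H) :
    galoisMap k H (a ⊗ₜ b) = (a ⊗ₜ 1) * comul (R := k) b := by
  have : ∀ x : H ⊗[k] H, (LinearMap.mul' k H).rTensor H
      ((TensorProduct.assoc k H H H).symm (a ⊗ₜ x)) = (a ⊗ₜ 1) * x := by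
    intro x
    induction x with
    | zero => simp
    | tmul b c => simp
    | add x y hx hy => simp only [map_add, TensorProduct.tmul_add, mul_add, hx, hy]
  simpa [galoisMap] using this (comul b)

lemma galoisMap_surjective : Function.Surjective (galoisMap k H) := by
  have key : ∀ b : H, galoisMap k H ((antipode k).rTensor H (comul b)) = 1 ⊗ₜ b := by
    intro b
    have h : ∀ x : H ⊗[k] H, galoisMap k H ((antipode k).rTensor H x) =
        (LinearMap.mul' k H ∘ₗ (antipode k).rTensor H).rTensor H
          ((TensorProduct.assoc k H H H).symm (comul.lTensor H x)) := by
      intro x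
      rw [LinearMap.rTensor_comp]
      simp only [galoisMap, LinearMap.comp_apply, LinearEquiv.coe_coe]
      congr 1
      induction x with
      | zero => simp
      | tmul c d =>
        simp only [LinearMap.rTensor_tmul, LinearMap.lTensor_tmul]
        induction comul (R := k) d with
        | zero => simp
        | tmul e f => simp
        | add x y hx hy => simp only [map_add, TensorProduct.tmul_add, hx, hy]
      | add x y hx hy => simp only [map_add, hx, hy]
    rw [h, coassoc_symm_apply, ← LinearMap.comp_apply, ← LinearMap.rTensor_comp,
      LinearMap.comp_assoc, mul_antipode_rTensor_comul, LinearMap.rTensor_comp,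
      LinearMap.comp_apply, rTensor_counit_comul]
    simp
  have hmul : ∀ (a : H) (x : H ⊗[k] H),
      galoisMap k H ((a ⊗ₜ 1) * x) = (a ⊗ₜ 1) * galoisMap k H x := by
    intro a x
    induction x with
    | zero => simp
    | tmul b c => simp [galoisMap_tmul, ← mul_assoc]
    | add x y hx hy => simp only [map_add, mul_add, hx, hy]
  intro x
  induction x with
  | zero => exact ⟨0, map_zero _⟩
  | tmul a b => exact ⟨_, (hmul a _).trans (by rw [key b]; simp)⟩
  | add x y hx hy =>
    obtain ⟨x', rfl⟩ := hx
    obtain ⟨y', rfl⟩ := hy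
    exact ⟨x' + y', map_add _ _ _⟩

end Shear

section Translation

variable (k H) in
/-- The algebra automorphisms of `H` commuting with the right coaction of `H` on itself. -/
def colinearAut : Subgroup (H ≃ₐ[k] H) where
  carrier := {f | comul ∘ₗ f.toLinearMap = f.toLinearMap.rTensor H ∘ₗ comul (R := k)}
  one_mem' := by
    have : (1 : H ≃ₐ[k] H).toLinearMap = LinearMap.id := rfl
    simp [this]
  mul_mem' {f g} hf hg := by
    have : (f * g).toLinearMap = f.toLinearMap ∘ₗ g.toLinearMap := rfl
    simp only [Set.mem_ofPred_eq] at *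
    rw [this, ← LinearMap.comp_assoc, hf, LinearMap.comp_assoc, hg, LinearMap.rTensor_comp,
      LinearMap.comp_assoc]
  inv_mem' {f} hf := by
    have h₁ : f.toLinearMap ∘ₗ f⁻¹.toLinearMap = LinearMap.id := by
      ext x; exact f.apply_symm_apply x
    have h₂ : f⁻¹.toLinearMap ∘ₗ f.toLinearMap = LinearMap.id := by
      ext x; exact f.symm_apply_apply x
    simp only [Set.mem_ofPred_eq] at *
    calc comul ∘ₗ f⁻¹.toLinearMap
        = (f⁻¹.toLinearMap ∘ₗ f.toLinearMap).rTensor H ∘ₗ comul (R := k) ∘ₗ f⁻¹.toLinearMap := by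
          rw [h₂, LinearMap.rTensor_id, LinearMap.id_comp]
      _ = f⁻¹.toLinearMap.rTensor H ∘ₗ comul (R := k) ∘ₗ f.toLinearMap ∘ₗ f⁻¹.toLinearMap := by
          rw [LinearMap.rTensor_comp, LinearMap.comp_assoc, ← LinearMap.comp_assoc _ comul, ← hf,
            LinearMap.comp_assoc]
      _ = _ := by rw [h₁, LinearMap.comp_id]

/-- The representation of `colinearAut k H` on `H`. -/
def colinearRep : Representation k (colinearAut k H) H where
  toFun f := f.1.toLinearMap
  map_one' := rfl
  map_mul' _ _ := rfl

lemma colinearRep_apply (f : colinearAut k H) (h : H) : colinearRep f h = f.1 h := rfl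

lemma galoisMap_comp_tprod (f : colinearAut k H) :
    galoisMap k H ∘ₗ (colinearRep.tprod colinearRep) f =
      (colinearRep.tprod (Representation.trivial k (colinearAut k H) H)) f ∘ₗ galoisMap k H := by
  ext a b
  have h : comul (R := k) (f.1 b) = f.1.toLinearMap.rTensor H (comul b) :=
    LinearMap.congr_fun f.2 b
  have hmul : ∀ x : H ⊗[k] H, (f.1 a ⊗ₜ 1) * f.1.toLinearMap.rTensor H x =
      (colinearRep.tprod (Representation.trivial k (colinearAut k H) H)) f ((a ⊗ₜ 1) * x) := by
    intro x
    induction x with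
    | zero => simp
    | tmul b c => simp [colinearRep_apply]
    | add x y hx hy => simp only [map_add, mul_add, hx, hy]
  simp [galoisMap_tmul, colinearRep_apply, h, hmul]

/-- The translation `h ↦ χ(h₍₁₎) h₍₂₎` by a linear functional `χ`. -/
noncomputable def translation (χ : H →ₗ[k] k) : H →ₗ[k] H :=
  (TensorProduct.lid k H).toLinearMap ∘ₗ χ.rTensor H ∘ₗ comul

lemma translation_counit : translation (counit (R := k) (A := H)) = LinearMap.id := by
  ext h
  simp [translation]

lemma comul_comp_translation (χ : H →ₗ[k] k) :
    comul ∘ₗ translation χ = (translation χ).rTensor H ∘ₗ comul := by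
  have key : ∀ x : H ⊗[k] H, comul (R := k) (TensorProduct.lid k H (χ.rTensor H x)) =
      ((TensorProduct.lid k H).toLinearMap ∘ₗ χ.rTensor H).rTensor H
        ((TensorProduct.assoc k H H H).symm (comul.lTensor H x)) := by
    intro x
    induction x with
    | zero => simp
    | tmul a b =>
      simp only [LinearMap.rTensor_tmul, LinearMap.lTensor_tmul, TensorProduct.lid_tmul, map_smul]
      induction comul (R := k) b with
      | zero => simp
      | tmul c d => simp [TensorProduct.smul_tmul']
      | add x y hx hy => simp only [map_add, TensorProduct.tmul_add, smul_add, hx, hy]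
    | add x y hx hy => simp only [map_add, hx, hy]
  ext h
  simp only [translation, LinearMap.comp_apply, LinearEquiv.coe_coe, key, coassoc_symm_apply]
  simp only [LinearMap.rTensor_comp, LinearMap.comp_apply]

lemma translation_comp_of_comul_comp {f : H →ₗ[k] H} (hf : comul ∘ₗ f = f.rTensor H ∘ₗ comul)
    (χ : H →ₗ[k] k) : translation χ ∘ₗ f = translation (χ ∘ₗ f) := by
  rw [translation, LinearMap.comp_assoc, LinearMap.comp_assoc, hf, translation,
    LinearMap.rTensor_comp, LinearMap.comp_assoc]

lemma counit_comp_translation (χ : H →ₗ[k] k) : counit ∘ₗ translation χ = χ := by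
  ext h
  have key : ∀ x : H ⊗[k] H, counit (R := k) (TensorProduct.lid k H (χ.rTensor H x)) =
      χ (TensorProduct.rid k H (counit.lTensor H x)) := by
    intro x
    induction x with
    | zero => simp
    | tmul a b => simp [mul_comm]
    | add x y hx hy => simp only [map_add, hx, hy]
  simp [translation, key]

lemma translation_comp_translation_antipode (χ : H →ₐ[k] k) :
    translation (χ.toLinearMap ∘ₗ antipode k) ∘ₗ translation χ.toLinearMap = LinearMap.id := by
  rw [translation_comp_of_comul_comp (comul_comp_translation _), ← translation_counit]
  congr 1
  ext h
  have key : ∀ x : H ⊗[k] H,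
      χ (antipode k (TensorProduct.lid k H (χ.toLinearMap.rTensor H x))) =
        χ (LinearMap.mul' k H ((antipode k).lTensor H x)) := by
    intro x
    induction x with
    | zero => simp
    | tmul a b => simp
    | add x y hx hy => simp only [map_add, hx, hy]
  simp [translation, key]

/-- Translation by an algebra map, as an algebra map. -/
noncomputable def translationAlgHom (χ : H →ₐ[k] k) : H →ₐ[k] H :=
  (Algebra.TensorProduct.lid k H).toAlgHom.comp
    ((Algebra.TensorProduct.map χ (AlgHom.id k H)).comp (comulAlgHom k H))

lemma toLinearMap_translationAlgHom (χ : H →ₐ[k] k) :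
    (translationAlgHom χ).toLinearMap = translation χ.toLinearMap := rfl

lemma eq_translation_of_mem_colinearAut {f : H ≃ₐ[k] H} (hf : f ∈ colinearAut k H) :
    f.toLinearMap = translation (counit ∘ₗ f.toLinearMap) := by
  rw [← translation_comp_of_comul_comp hf, translation_counit, LinearMap.id_comp]

variable [FiniteDimensional k H]

lemma bijective_counitAlgHom_comp :
    Function.Bijective fun f : colinearAut k H =>
      (counitAlgHom k H).comp (f : H ≃ₐ[k] H).toAlgHom := by
  constructor
  · intro f g hfg
    have h : counit ∘ₗ f.1.toLinearMap = counit (R := k) ∘ₗ g.1.toLinearMap :=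
      congrArg AlgHom.toLinearMap hfg
    ext x
    have := (eq_translation_of_mem_colinearAut f.2).trans
      ((congrArg translation h).trans (eq_translation_of_mem_colinearAut g.2).symm)
    exact LinearMap.congr_fun this x
  · intro χ
    have hinj : Function.Injective (translationAlgHom χ).toLinearMap :=
      Function.LeftInverse.injective (g := translation (χ.toLinearMap ∘ₗ antipode k))
        (LinearMap.congr_fun (translation_comp_translation_antipode χ))
    refine ⟨⟨AlgEquiv.ofBijective (translationAlgHom χ)
      ⟨hinj, LinearMap.injective_iff_surjective.1 hinj⟩, comul_comp_translation χ.toLinearMap⟩, ?_⟩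
    ext h
    exact LinearMap.congr_fun (counit_comp_translation χ.toLinearMap) h

end Translation

lemma exists_algHom_apply_eq_ite [DecidableEq (H →ₐ[k] k)] [FiniteDimensional k H]
    (χ₀ : H →ₐ[k] k) : ∃ h : H, ∀ χ : H →ₐ[k] k, χ h = if χ = χ₀ then 1 else 0 := by
  have hli : LinearIndependent k fun χ : H →ₐ[k] k => (χ : H → k) :=
    (linearIndependent_monoidHom H k).comp (fun χ : H →ₐ[k] k => (χ : H →* k)) fun χ ψ h =>
      AlgHom.ext fun x => DFunLike.congr_fun h x
  have hspan := span_flip_eq_top_iff_linearIndependent.2 hli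
  let p : H →ₗ[k] ((H →ₐ[k] k) → k) := LinearMap.pi fun χ => χ.toLinearMap
  have hp : LinearMap.range p = ⊤ := by
    rw [eq_top_iff, ← hspan, Submodule.span_le]
    rintro _ ⟨h, rfl⟩
    exact ⟨h, rfl⟩
  obtain ⟨h, hh⟩ := LinearMap.range_eq_top.1 hp fun χ => if χ = χ₀ then 1 else 0
  exact ⟨h, congrFun hh⟩

end HopfAlgebra

/-- For a finite-dimensional Hopf algebra `H` over a field `k`, the
number of one-dimensional representations of `H` — i.e. of algebra maps `H → k`,
equivalently of grouplike elements of the dual Hopf algebra `H*` — divides `dim H`. -/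
theorem card_algHom_dvd_finrank
    {k : Type*} [Field k] {H : Type*} [Ring H] [HopfAlgebra k H] [FiniteDimensional k H] :
    Nat.card (H →ₐ[k] k) ∣ Module.finrank k H := by
  classical
  have hbij := HopfAlgebra.bijective_counitAlgHom_comp (k := k) (H := H)
  have : Finite (HopfAlgebra.colinearAut k H) := Finite.of_injective _ hbij.1
  obtain ⟨h₀, hh₀⟩ :=
    HopfAlgebra.exists_algHom_apply_eq_ite (Bialgebra.counitAlgHom k H)
  rw [← Nat.card_eq_of_bijective _ hbij]
  have hsurj := HopfAlgebra.galoisMap_surjective (k := k) (H := H)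
  let Φ := LinearEquiv.ofBijective (HopfAlgebra.galoisMap k H)
    ⟨LinearMap.injective_iff_surjective.2 hsurj, hsurj⟩
  have h₁ : Coalgebra.counit (R := k) h₀ = 1 := by
    simpa using hh₀ (Bialgebra.counitAlgHom k H)
  have h₂ : ∀ g : HopfAlgebra.colinearAut k H, g ≠ 1 →
      Coalgebra.counit (R := k) (HopfAlgebra.colinearRep g h₀) = 0 := fun g hg =>
    (hh₀ ((Bialgebra.counitAlgHom k H).comp g.1.toAlgHom)).trans
      (if_neg fun h => hg (hbij.1 (a₂ := 1) h))
  exact Dvd.intro _ (Representation.card_mul_finrank_invariants_eq _ _ h₀ h₁ h₂ Φ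
    HopfAlgebra.galoisMap_comp_tprod)
end
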